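/- arXiv:2410.21953 — 5 statements merged into one kernel-verified Lean document; each statement's English description precedes it below -/
import Mathlib

section
/- Let t be a natural number and let f : ℝ → ℝ be a function with finite support of size at most t. If Σ^i(f) = 0 for all integers i with 0 ≤ i ≤ t − 1, then f is identically zero. -/
/-- **Uniqueness half of sparse interpolation.**
If `f : ℝ → ℝ` has finite support of size at most `t` and `Σ^i(f) = 0` for all `0 ≤ i ≤ t-1`,
then `f` is identically zero. Here `Σ^i(f) = ∑_x x^i · f(x)`. -/
theorem sparse_interpolation_unique (t : ℕ) (f : ℝ → ℝ)
    (hf : (Function.support f).Finite) (hcard : hf.toFinset.card ≤ t)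
    (h : ∀ i < t, ∑ᶠ x : ℝ, x ^ i * f x = 0) : f = 0 := by
  have hsum : ∀ i < t, ∑ x ∈ hf.toFinset, f x * x ^ i = 0 := by
    intro i hi
    rw [← h i hi, finsum_eq_sum_of_support_subset (s := hf.toFinset)]
    · exact Finset.sum_congr rfl fun x _ => mul_comm _ _
    · intro x hx
      have hx' : x ^ i * f x ≠ 0 := hx
      simpa using right_ne_zero_of_mul hx'
  let e := hf.toFinset.equivFin.symm
  have hv : (fun j => f (e j : ℝ)) = 0 := by
    refine Matrix.eq_zero_of_forall_pow_sum_mul_pow_eq_zero (f := fun j => (e j : ℝ))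
      (Subtype.val_injective.comp e.injective) fun i => ?_
    rw [e.sum_comp (fun x : hf.toFinset => f (x : ℝ) * (x : ℝ) ^ (i : ℕ)),
      Finset.sum_coe_sort hf.toFinset (fun x => f x * x ^ (i : ℕ))]
    exact hsum i (lt_of_lt_of_le i.isLt hcard)
  funext x
  by_contra hx
  have hx' : x ∈ hf.toFinset := by simpa using hx
  have h2 := congrFun hv (e.symm ⟨x, hx'⟩)
  simp only [Equiv.apply_symm_apply] at h2
  exact hx h2
end

section
/- Let 𝔽 be a field, let t be a natural number, let f ∈ 𝔽[X] be a polynomial with at most t nonzero coefficients, and let ω ∈ 𝔽 be a nonzero element with ω^k ≠ 1 for all integers 1 ≤ k ≤ deg(f). If f(ω^i) = 0 for all integers 0 ≤ i ≤ t − 1, then f = 0. -/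
open Polynomial in
/-- **Uniqueness half of sparse evaluation/interpolation over a field.**
If `f ∈ 𝔽[X]` has at most `t` nonzero coefficients, `ω ≠ 0` satisfies `ω^k ≠ 1` for all
`1 ≤ k ≤ deg f`, and `f(ω^i) = 0` for all `0 ≤ i ≤ t - 1`, then `f = 0`. -/
theorem sparse_polynomial_vanishing {F : Type*} [Field F] (t : ℕ) (f : F[X])
    (hcard : f.support.card ≤ t) (ω : F) (hω : ω ≠ 0)
    (hord : ∀ k : ℕ, 1 ≤ k → k ≤ f.natDegree → ω ^ k ≠ 1)
    (hz : ∀ i < t, f.eval (ω ^ i) = 0) : f = 0 := by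
  set e := f.support.equivFin.symm with he
  have key : ∀ a b : ℕ, a < b → b ≤ f.natDegree → ω ^ a ≠ ω ^ b := by
    intro a b hab hb h
    apply hord (b - a) (by omega) (by omega)
    have h2 : ω ^ a * ω ^ (b - a) = ω ^ a * 1 := by
      rw [← pow_add, mul_one, h]
      congr 1
      omega
    exact mul_left_cancel₀ (pow_ne_zero a hω) h2
  have hinj : Function.Injective
      (fun j : Fin f.support.card => ω ^ ((e j : f.support) : ℕ)) := by
    intro j k hjk
    have hj := Polynomial.le_natDegree_of_mem_supp _ (e j).2
    have hk := Polynomial.le_natDegree_of_mem_supp _ (e k).2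
    apply e.injective
    apply Subtype.ext
    rcases lt_trichotomy ((e j : f.support) : ℕ) (e k) with h | h | h
    · exact absurd hjk (key _ _ h hk)
    · exact h
    · exact absurd hjk.symm (key _ _ h hj)
  have hzero := Matrix.eq_zero_of_forall_pow_sum_mul_pow_eq_zero
    (v := fun j : Fin f.support.card => f.coeff (e j)) hinj (by
      intro i
      have h := hz i (lt_of_lt_of_le i.2 hcard)
      rw [Polynomial.eval_eq_sum, Polynomial.sum_def, ← Finset.sum_coe_sort,
        ← e.sum_comp] at h
      rw [← h]
      refine Finset.sum_congr rfl fun j _ => ?_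
      rw [← pow_mul, ← pow_mul, mul_comm (i : ℕ)])
  ext n
  by_contra hn
  have hmem : n ∈ f.support := Polynomial.mem_support_iff.2 (by simpa using hn)
  have h := congrFun hzero (e.symm ⟨n, hmem⟩)
  simp only [Equiv.apply_symm_apply, Pi.zero_apply] at h
  exact hn (by simpa using h)
end

section
/- Let u ≥ 0 and let A, B be finite subsets of the real interval [0, u], and set C = (A + B) ∩ [0, u]. Let g ≥ 2 be an integer and suppose A is partitioned into nonempty parts A_1, …, A_g and B is partitioned into nonempty parts B_1, …, B_g satisfying: (i) max(A_i) < min(A_{i+1}) for all 1 ≤ i < g, and min(B_i) > max(B_{i+1}) for all 1 ≤ i < g; (ii) A_i + B_j ⊆ [0, u] for all 1 ≤ i < j ≤ g; (iii) there exist integers n, m ≥ 1 with n ≤ |A_i| ≤ 2n and m ≤ |B_i| ≤ 2m for all i; (iv) |A_ℓ + B_ℓ| > |C| for all 1 ≤ ℓ ≤ g. Then g < 258 · |C|^{1/3}. -/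
open Pointwise in
/-- A box of pieces contributes at most `2 h |C|` in total. -/
lemma box_sum_le (C : Finset ℝ) (F G : ℕ → Finset ℝ) (h : ℕ)
    (hF : ∀ i i', i < i' → i' < h → ∀ x ∈ F i, ∀ y ∈ F i', x < y)
    (hG : ∀ i i', i < i' → i' < h → ∀ x ∈ G i, ∀ y ∈ G i', y < x)
    (hsub : ∀ i < h, ∀ j < h, F i + G j ⊆ C) :
    ∑ i ∈ Finset.range h, ∑ j ∈ Finset.range h, (F i + G j).card ≤ 2 * h * C.card := by
  classical
  rw [← Finset.sum_product' (f := fun i j => (F i + G j).card)]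
  let r : ℕ × ℕ → ℝ → Prop := fun p x => x ∈ F p.1 + G p.2
  have e : ∀ p ∈ Finset.range h ×ˢ Finset.range h,
      (F p.1 + G p.2).card = (C.bipartiteAbove r p).card := by
    intro p hp
    simp only [Finset.mem_product, Finset.mem_range] at hp
    congr 1
    ext x
    simp only [Finset.mem_bipartiteAbove, r]
    exact ⟨fun hx => ⟨hsub _ hp.1 _ hp.2 hx, hx⟩, fun hx => hx.2⟩
  rw [Finset.sum_congr rfl e, Finset.sum_card_bipartiteAbove_eq_sum_card_bipartiteBelow]
  have key : ∀ x ∈ C,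
      (Finset.bipartiteBelow r (Finset.range h ×ˢ Finset.range h) x).card ≤ 2 * h := by
    intro x _
    have := Finset.card_le_card_of_injOn (s := Finset.bipartiteBelow r
      (Finset.range h ×ˢ Finset.range h) x) (t := Finset.range (2 * h)) (fun p => p.1 + p.2)
      (by
        rintro ⟨i, j⟩ hp
        simp only [Finset.mem_coe, Finset.mem_bipartiteBelow, Finset.mem_product,
          Finset.mem_range] at hp ⊢
        omega)
      (by
        rintro ⟨i, j⟩ hp ⟨i', j'⟩ hq hpq
        simp only [Finset.mem_coe, Finset.mem_bipartiteBelow, Finset.mem_product,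
          Finset.mem_range, r, Finset.mem_add] at hp hq hpq
        obtain ⟨⟨hi, hj⟩, a, ha, b, hb, hab⟩ := hp
        obtain ⟨⟨hi', hj'⟩, a', ha', b', hb', hab'⟩ := hq
        rcases lt_trichotomy i i' with hlt | heq | hlt
        · have h1 := hF i i' hlt hi' a ha a' ha'
          have h2 := hG j' j (by omega) hj b' hb' b hb
          linarith
        · have : j = j' := by omega
          rw [heq, this]
        · have h1 := hF i' i hlt hi a' ha' a ha
          have h2 := hG j j' (by omega) hj' b hb b' hb'
          linarith)
    simpa using this
  calc _ ≤ ∑ _x ∈ C, 2 * h := Finset.sum_le_sum key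
    _ = 2 * h * C.card := by simp [mul_comm]

/-- Averaging over triples. -/
lemma exists_triple (f : ℕ → ℕ → ℕ) (h c : ℕ) (hh : 0 < h)
    (h1 : ∑ i ∈ Finset.range h, ∑ j ∈ Finset.range h, f i (2 * h + j) ≤ 2 * h * c)
    (h2 : ∑ i ∈ Finset.range h, ∑ j ∈ Finset.range h, f i (h + j) ≤ 2 * h * c)
    (h3 : ∑ i ∈ Finset.range h, ∑ j ∈ Finset.range h, f (h + i) (2 * h + j) ≤ 2 * h * c) :
    ∃ i < h, ∃ l < h, ∃ j < h,
      h * (f i (2 * h + j) + f i (h + l) + f (h + l) (2 * h + j)) ≤ 6 * c := by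
  by_contra! hcon
  have lt : ∑ i ∈ Finset.range h, ∑ l ∈ Finset.range h, ∑ j ∈ Finset.range h, 6 * c
      < ∑ i ∈ Finset.range h, ∑ l ∈ Finset.range h, ∑ j ∈ Finset.range h,
        h * (f i (2 * h + j) + f i (h + l) + f (h + l) (2 * h + j)) := by
    have hne : (Finset.range h).Nonempty := Finset.nonempty_range_iff.2 hh.ne'
    refine Finset.sum_lt_sum_of_nonempty hne fun i hi => ?_
    refine Finset.sum_lt_sum_of_nonempty hne fun l hl => ?_
    refine Finset.sum_lt_sum_of_nonempty hne fun j hj => ?_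
    exact hcon i (Finset.mem_range.1 hi) l (Finset.mem_range.1 hl) j (Finset.mem_range.1 hj)
  simp only [← Finset.mul_sum, Finset.sum_add_distrib, Finset.sum_const, Finset.card_range,
    smul_eq_mul] at lt
  have := Nat.mul_le_mul_left (h * h) h1
  have := Nat.mul_le_mul_left (h * h) h2
  have := Nat.mul_le_mul_left (h * h) h3
  nlinarith

open Pointwise in
/-- Two applications of Ruzsa's triangle inequality. -/
lemma ruzsa_two (X Y Z W : Finset ℝ) :
    (X + W).card * (Z.card * Y.card) ≤ (X + Y).card * (Z + Y).card * (Z + W).card := by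
  have a1 := Finset.ruzsa_triangle_inequality_sub_add_add Z Y X
  have a2 := Finset.ruzsa_triangle_inequality_add_sub_add X Z W
  calc (X + W).card * (Z.card * Y.card) = (Z.card * (X + W).card) * Y.card := by ring
    _ ≤ ((Z - X).card * (Z + W).card) * Y.card := Nat.mul_le_mul_right _ a2
    _ = ((Z - X).card * Y.card) * (Z + W).card := by ring
    _ ≤ ((Z + Y).card * (X + Y).card) * (Z + W).card := Nat.mul_le_mul_right _ a1
    _ = _ := by ring

/-- The final arithmetic. -/
lemma final_arith (x y z h c s n m : ℝ) (hx : 0 ≤ x) (hy : 0 ≤ y) (hz : 0 ≤ z) (hh : 0 ≤ h)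
    (hc : 0 < c) (hn : 0 < n) (hm : 0 < m) (h1 : h * (x + y + z) ≤ 6 * c)
    (hs : c < s) (h2 : s * (n * m) ≤ x * y * z) (h3 : s ≤ 4 * (n * m)) :
    h ^ 3 < 32 * c := by
  have amgm : 27 * (x * y * z) ≤ (x + y + z) ^ 3 := by
    nlinarith [mul_nonneg hx (sq_nonneg (y - z)), mul_nonneg hy (sq_nonneg (x - z)),
      mul_nonneg hz (sq_nonneg (x - y)), mul_nonneg hx (sq_nonneg (x - y)),
      mul_nonneg hx (sq_nonneg (x - z)), mul_nonneg hy (sq_nonneg (y - x)),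
      mul_nonneg hy (sq_nonneg (y - z)), mul_nonneg hz (sq_nonneg (z - x)),
      mul_nonneg hz (sq_nonneg (z - y))]
  have p1 : c ^ 2 < 4 * (x * y * z) := by nlinarith
  have p2 : (h * (x + y + z)) ^ 3 ≤ (6 * c) ^ 3 := by gcongr
  have p3 : h ^ 3 * (27 * (x * y * z)) ≤ (6 * c) ^ 3 := by
    calc _ ≤ h ^ 3 * (x + y + z) ^ 3 := by gcongr
      _ = (h * (x + y + z)) ^ 3 := by ring
      _ ≤ _ := p2
  by_contra! hcon
  have p4 : 32 * c * (27 * (x * y * z)) ≤ (6 * c) ^ 3 := by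
    refine le_trans ?_ p3
    gcongr
  have p5 : 32 * c * 27 * c ^ 2 < 32 * c * 27 * (4 * (x * y * z)) := by gcongr
  nlinarith

/-- Consecutive strict ordering of nonempty pieces is transitive. -/
lemma ord_trans (r : ℝ → ℝ → Prop) [IsTrans ℝ r] (F : ℕ → Finset ℝ) (g : ℕ)
    (hne : ∀ i < g, (F i).Nonempty)
    (h : ∀ i, i + 1 < g → ∀ x ∈ F i, ∀ y ∈ F (i + 1), r x y) :
    ∀ i j, i < j → j < g → ∀ x ∈ F i, ∀ y ∈ F j, r x y := by
  intro i j hij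
  induction j, hij using Nat.le_induction with
  | base => intro hj; exact h i hj
  | succ k hk ih =>
    intro hj x hx y hy
    obtain ⟨w, hw⟩ := hne k (by omega)
    exact _root_.trans (ih (by omega) x hx w hw) (h k hj w hw y hy)

open Pointwise in
/-- **Staircase lemma for prefix-restricted sumsets.**
Let `A, B ⊆ [0, u]` be finite, `C = (A + B) ∩ [0, u]`, and let `A = A₀ ⊔ ⋯ ⊔ A_{g-1}`,
`B = B₀ ⊔ ⋯ ⊔ B_{g-1}` (with `g ≥ 2`) be partitions into nonempty parts such that
(i) the `Aᵢ` are increasing and the `Bᵢ` are decreasing, (ii) `Aᵢ + Bⱼ ⊆ [0, u]` for `i < j`,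
(iii) all `|Aᵢ| ∈ [n, 2n]` and `|Bᵢ| ∈ [m, 2m]` for some `n, m ≥ 1`, and
(iv) `|A_ℓ + B_ℓ| > |C|` for all `ℓ`. Then `g < 258 · |C|^{1/3}`. -/
theorem staircase_lemma (u : ℝ) (hu : 0 ≤ u) (A B : Finset ℝ)
    (hAu : ∀ x ∈ A, x ∈ Set.Icc (0 : ℝ) u) (hBu : ∀ x ∈ B, x ∈ Set.Icc (0 : ℝ) u)
    (C : Finset ℝ) (hC : C = (A + B).filter (fun x => 0 ≤ x ∧ x ≤ u))
    (g : ℕ) (hg : 2 ≤ g) (𝒜 ℬ : ℕ → Finset ℝ)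
    (hAcover : (Finset.range g).biUnion 𝒜 = A)
    (hBcover : (Finset.range g).biUnion ℬ = B)
    (hAdisj : ∀ i < g, ∀ j < g, i ≠ j → Disjoint (𝒜 i) (𝒜 j))
    (hBdisj : ∀ i < g, ∀ j < g, i ≠ j → Disjoint (ℬ i) (ℬ j))
    (hAne : ∀ i < g, (𝒜 i).Nonempty) (hBne : ∀ i < g, (ℬ i).Nonempty)
    -- (i): parts of A are increasing, parts of B are decreasing
    (hAord : ∀ i, i + 1 < g → ∀ x ∈ 𝒜 i, ∀ y ∈ 𝒜 (i + 1), x < y)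
    (hBord : ∀ i, i + 1 < g → ∀ x ∈ ℬ i, ∀ y ∈ ℬ (i + 1), y < x)
    -- (ii)
    (hij : ∀ i j, i < j → j < g → ∀ z ∈ 𝒜 i + ℬ j, z ∈ Set.Icc (0 : ℝ) u)
    -- (iii)
    (hsizes : ∃ n m : ℕ, 1 ≤ n ∧ 1 ≤ m ∧ ∀ i < g,
      (n ≤ (𝒜 i).card ∧ (𝒜 i).card ≤ 2 * n) ∧ (m ≤ (ℬ i).card ∧ (ℬ i).card ≤ 2 * m))
    -- (iv)
    (hheavy : ∀ l < g, C.card < (𝒜 l + ℬ l).card) :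
    (g : ℝ) < 258 * (C.card : ℝ) ^ ((1 : ℝ) / 3) := by
  classical
  obtain ⟨n, m, hn, hm, hsz⟩ := hsizes
  have hA := ord_trans (· < ·) 𝒜 g hAne hAord
  have hB := ord_trans (fun x y => y < x) ℬ g hBne hBord
  have hsub : ∀ i j, i < j → j < g → 𝒜 i + ℬ j ⊆ C := by
    intro i j h1 h2 z hz
    rw [hC, Finset.mem_filter]
    refine ⟨?_, hij i j h1 h2 z hz⟩
    refine Finset.add_subset_add ?_ ?_ hz
    · rw [← hAcover]
      exact Finset.subset_biUnion_of_mem 𝒜 (Finset.mem_range.2 (by omega))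
    · rw [← hBcover]
      exact Finset.subset_biUnion_of_mem ℬ (Finset.mem_range.2 h2)
  have hcpos : 0 < C.card :=
    Finset.card_pos.2 (((hAne 0 (by omega)).add (hBne 1 (by omega))).mono
      (hsub 0 1 (by omega) (by omega)))
  have hcR : (0 : ℝ) < C.card := by exact_mod_cast hcpos
  have hc1 : (1 : ℝ) ≤ C.card := by exact_mod_cast hcpos
  have main : (g : ℝ) ^ 3 < 258 ^ 3 * C.card := by
    rcases Nat.lt_or_ge g 3 with hg3 | hg3
    · have : g = 2 := by omega
      subst this
      norm_num
      linarith
    obtain ⟨h, hh⟩ : ∃ h, h = g / 3 := ⟨_, rfl⟩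
    have hpos : 0 < h := by omega
    have h3g : 3 * h ≤ g := by omega
    have hg5 : g ≤ 5 * h := by omega
    have b1 := box_sum_le C 𝒜 (fun j => ℬ (2 * h + j)) h
      (fun i i' h1 h2 => hA i i' h1 (by omega))
      (fun i i' h1 h2 => hB _ _ (by omega) (by omega))
      (fun i hi j hj => hsub _ _ (by omega) (by omega))
    have b2 := box_sum_le C 𝒜 (fun j => ℬ (h + j)) h
      (fun i i' h1 h2 => hA i i' h1 (by omega))
      (fun i i' h1 h2 => hB _ _ (by omega) (by omega))
      (fun i hi j hj => hsub _ _ (by omega) (by omega))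
    have b3 := box_sum_le C (fun i => 𝒜 (h + i)) (fun j => ℬ (2 * h + j)) h
      (fun i i' h1 h2 => hA _ _ (by omega) (by omega))
      (fun i i' h1 h2 => hB _ _ (by omega) (by omega))
      (fun i hi j hj => hsub _ _ (by omega) (by omega))
    obtain ⟨i, hi, l, hl, j, hj, ht⟩ :=
      exists_triple (fun i j => (𝒜 i + ℬ j).card) h C.card hpos b1 b2 b3
    have hr := ruzsa_two (𝒜 (h + l)) (ℬ (2 * h + j)) (𝒜 i) (ℬ (h + l))
    have hs := hheavy (h + l) (by omega)
    have hs4 : (𝒜 (h + l) + ℬ (h + l)).card ≤ 4 * (n * m) := by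
      have hl' := hsz (h + l) (by omega)
      calc _ ≤ (𝒜 (h + l)).card * (ℬ (h + l)).card := Finset.card_add_le
        _ ≤ (2 * n) * (2 * m) := Nat.mul_le_mul hl'.1.2 hl'.2.2
        _ = _ := by ring
    have hr' : (𝒜 (h + l) + ℬ (h + l)).card * (n * m) ≤
        (𝒜 i + ℬ (2 * h + j)).card * (𝒜 i + ℬ (h + l)).card *
          (𝒜 (h + l) + ℬ (2 * h + j)).card := by
      calc _ ≤ (𝒜 (h + l) + ℬ (h + l)).card * ((𝒜 i).card * (ℬ (2 * h + j)).card) :=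
            Nat.mul_le_mul_left _ (Nat.mul_le_mul (hsz i (by omega)).1.1
              (hsz (2 * h + j) (by omega)).2.1)
        _ ≤ _ := hr
        _ = _ := by ring
    have fin := final_arith ((𝒜 i + ℬ (2 * h + j)).card) ((𝒜 i + ℬ (h + l)).card)
      ((𝒜 (h + l) + ℬ (2 * h + j)).card) h C.card ((𝒜 (h + l) + ℬ (h + l)).card) n m
      (by positivity) (by positivity) (by positivity) (by positivity) hcR
      (by exact_mod_cast hn) (by exact_mod_cast hm) (by exact_mod_cast ht)
      (by exact_mod_cast hs) (by exact_mod_cast hr') (by exact_mod_cast hs4)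
    have hgR : (g : ℝ) ≤ 5 * h := by exact_mod_cast hg5
    have : (g : ℝ) ^ 3 ≤ (5 * h) ^ 3 := by gcongr
    nlinarith
  have hcube : ((C.card : ℝ) ^ ((1 : ℝ) / 3)) ^ 3 = C.card := by
    rw [← Real.rpow_natCast, ← Real.rpow_mul hcR.le]
    norm_num
  refine lt_of_pow_lt_pow_left₀ 3 (by positivity) ?_
  rw [mul_pow, hcube]
  exact main
end

section
/- Let X be a finite multiset of nonnegative real numbers, let t ≥ 0, and let X = X_1 ⊎ X_2 be a partition of X into two sub-multisets. Then every x ∈ 𝒮(X, t) can be written as x = x_0 + x_1 + x_2, where x_0 is the sum of a sub-multiset of X of size at most four all of whose elements lie in the interval (t/4, t], x_1 is the sum of at most four (not necessarily distinct) elements of 𝒮(X_1, t/2), and x_2 is the sum of at most four (not necessarily distinct) elements of 𝒮(X_2, t/2). -/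
/-- The set of subset sums of the multiset `Y` capped at `r`:
`𝒮(Y, r) = {Σ(Y') : Y' ⊆ Y, Σ(Y') ≤ r}`. -/
def cappedSubsetSums (Y : Multiset ℝ) (r : ℝ) : Set ℝ :=
  {s : ℝ | ∃ Y' : Multiset ℝ, Y' ≤ Y ∧ Y'.sum = s ∧ s ≤ r}

theorem four_bins (q : ℝ) (M : Multiset ℝ) (h0 : ∀ y ∈ M, 0 ≤ y ∧ y ≤ q) (hs : M.sum ≤ 4 * q)
    (hq : 0 ≤ q) :
    ∃ A B C D : Multiset ℝ, A + B + C + D = M ∧ A.sum ≤ 2 * q ∧ B.sum ≤ 2 * q ∧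
      C.sum ≤ 2 * q ∧ D.sum ≤ 2 * q := by
  induction M using Multiset.induction_on with
  | empty => exact ⟨0, 0, 0, 0, by simp, by simpa, by simpa, by simpa, by simpa⟩
  | cons a M ih =>
    have ha := h0 a (Multiset.mem_cons_self a M)
    rw [Multiset.sum_cons] at hs
    obtain ⟨A, B, C, D, hM, hA, hB, hC, hD⟩ :=
      ih (fun y hy => h0 y (Multiset.mem_cons_of_mem hy)) (by linarith)
    have hsum : A.sum + B.sum + C.sum + D.sum = M.sum := by
      rw [← hM]; simp
    by_cases h1 : A.sum ≤ q
    · refine ⟨a ::ₘ A, B, C, D, by simp [← hM], ?_, hB, hC, hD⟩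
      rw [Multiset.sum_cons]; linarith
    by_cases h2 : B.sum ≤ q
    · refine ⟨A, a ::ₘ B, C, D, by simp [← hM], hA, ?_, hC, hD⟩
      rw [Multiset.sum_cons]; linarith
    by_cases h3 : C.sum ≤ q
    · refine ⟨A, B, a ::ₘ C, D, by simp [← hM], hA, hB, ?_, hD⟩
      rw [Multiset.sum_cons]; linarith
    · refine ⟨A, B, C, a ::ₘ D, by simp [← hM], hA, hB, hC, ?_⟩
      rw [Multiset.sum_cons]; linarith

theorem four_sums (t : ℝ) (ht : 0 ≤ t) (M Z : Multiset ℝ) (hMZ : M ≤ Z)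
    (h0 : ∀ y ∈ M, 0 ≤ y ∧ y ≤ t / 4) (hs : M.sum ≤ t) :
    ∃ L : Multiset ℝ, Multiset.card L ≤ 4 ∧
        (∀ y ∈ L, y ∈ cappedSubsetSums Z (t / 2)) ∧ L.sum = M.sum := by
  obtain ⟨A, B, C, D, hM, hA, hB, hC, hD⟩ :=
    four_bins (t / 4) M h0 (by linarith) (by linarith)
  have hle : ∀ E ≤ M, E.sum ≤ 2 * (t / 4) → E.sum ∈ cappedSubsetSums Z (t / 2) :=
    fun E hE h => ⟨E, hE.trans hMZ, rfl, by linarith⟩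
  have hD' : D ≤ M := by rw [← hM]; exact Multiset.le_add_left _ _
  have hABC : A + B + C ≤ M := by rw [← hM]; exact Multiset.le_add_right _ _
  have hC' : C ≤ M := (Multiset.le_add_left _ _).trans hABC
  have hAB : A + B ≤ M := (Multiset.le_add_right _ _).trans hABC
  have hB' : B ≤ M := (Multiset.le_add_left _ _).trans hAB
  have hA' : A ≤ M := (Multiset.le_add_right _ _).trans hAB
  refine ⟨{A.sum, B.sum, C.sum, D.sum}, by simp, ?_, ?_⟩
  · intro y hy
    simp only [Multiset.insert_eq_cons, Multiset.mem_cons, Multiset.mem_singleton] at hy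
    rcases hy with rfl | rfl | rfl | rfl
    · exact hle _ hA' hA
    · exact hle _ hB' hB
    · exact hle _ hC' hC
    · exact hle _ hD' hD
  · rw [← hM]; simp [add_assoc]

/-- **Decomposition of capped subset sums.**
Let `X` be a finite multiset of nonnegative reals, `t ≥ 0`, and `X = X₁ ⊎ X₂`. Every
`x ∈ 𝒮(X, t)` can be written as `x = x₀ + x₁ + x₂` where `x₀` is the sum of a sub-multiset
of `X` of size at most four all of whose elements lie in `(t/4, t]`, `x₁` is the sum of at
most four (not necessarily distinct) elements of `𝒮(X₁, t/2)`, and `x₂` is the sum of at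
most four (not necessarily distinct) elements of `𝒮(X₂, t/2)`. -/
theorem capped_subset_sum_decomposition (X X₁ X₂ : Multiset ℝ)
    (hXnn : ∀ x ∈ X, (0 : ℝ) ≤ x) (t : ℝ) (ht : 0 ≤ t) (hpart : X = X₁ + X₂)
    (x : ℝ) (hx : x ∈ cappedSubsetSums X t) :
    ∃ x₀ x₁ x₂ : ℝ, x = x₀ + x₁ + x₂ ∧
      (∃ Y₀ : Multiset ℝ, Y₀ ≤ X ∧ Multiset.card Y₀ ≤ 4 ∧
        (∀ y ∈ Y₀, t / 4 < y ∧ y ≤ t) ∧ Y₀.sum = x₀) ∧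
      (∃ L₁ : Multiset ℝ, Multiset.card L₁ ≤ 4 ∧
        (∀ y ∈ L₁, y ∈ cappedSubsetSums X₁ (t / 2)) ∧ L₁.sum = x₁) ∧
      (∃ L₂ : Multiset ℝ, Multiset.card L₂ ≤ 4 ∧
        (∀ y ∈ L₂, y ∈ cappedSubsetSums X₂ (t / 2)) ∧ L₂.sum = x₂) := by
  classical
  obtain ⟨Y, hYX, rfl, hYt⟩ := hx
  have hnn : ∀ y ∈ Y, 0 ≤ y := fun y hy => hXnn y (Multiset.mem_of_le hYX hy)
  have hmono : ∀ E ≤ Y, E.sum ≤ Y.sum := by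
    intro E hE
    obtain ⟨F, rfl⟩ := Multiset.le_iff_exists_add.1 hE
    have : 0 ≤ F.sum := Multiset.sum_nonneg fun y hy => hnn y (Multiset.mem_add.2 (Or.inr hy))
    rw [Multiset.sum_add]; linarith
  have hmem : ∀ y ∈ Y, y ≤ t := fun y hy => by
    have := hmono {y} (Multiset.singleton_le.2 hy)
    rw [Multiset.sum_singleton] at this
    linarith
  set P := Y.filter (fun y => t / 4 < y) with hP
  set S := Y.filter (fun y => ¬ t / 4 < y) with hS
  have hPS : P + S = Y := Multiset.filter_add_not _ _
  have hPY : P ≤ Y := Multiset.filter_le _ _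
  have hSY : S ≤ Y := Multiset.filter_le _ _
  have hPm : ∀ y ∈ P, t / 4 < y ∧ y ≤ t := fun y hy =>
    ⟨(Multiset.mem_filter.1 hy).2, hmem y (Multiset.mem_filter.1 hy).1⟩
  have hSm : ∀ y ∈ S, 0 ≤ y ∧ y ≤ t / 4 := fun y hy =>
    ⟨hnn y (Multiset.mem_filter.1 hy).1, not_lt.1 (Multiset.mem_filter.1 hy).2⟩
  have hcard : Multiset.card P ≤ 4 := by
    rcases ht.eq_or_lt with h | h
    · have : P = 0 := Multiset.eq_zero_of_forall_notMem fun y hy => by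
        have := hPm y hy
        linarith
      simp [this]
    · have h1 := Multiset.card_nsmul_le_sum (s := P) (a := t / 4) fun y hy => (hPm y hy).1.le
      have h2 := hmono P hPY
      rw [nsmul_eq_mul] at h1
      have : (Multiset.card P : ℝ) ≤ 4 := by
        by_contra hc
        push Not at hc
        nlinarith
      exact_mod_cast this
  have h1S : S ∩ X₁ ≤ S := Multiset.inter_le_left
  have h2S : S - X₁ ≤ S := tsub_le_self
  have h2X : S - X₁ ≤ X₂ := tsub_le_iff_left.2 (by rw [← hpart]; exact hSY.trans hYX)
  have hsplit : S ∩ X₁ + (S - X₁) = S := by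
    ext a
    simp only [Multiset.count_add, Multiset.count_inter, Multiset.count_sub]
    omega
  refine ⟨P.sum, (S ∩ X₁).sum, (S - X₁).sum, ?_, ⟨P, hPY.trans hYX, hcard, hPm, rfl⟩, ?_, ?_⟩
  · rw [add_assoc, ← Multiset.sum_add, hsplit, ← Multiset.sum_add, hPS]
  · exact four_sums t ht _ _ Multiset.inter_le_right
      (fun y hy => hSm y (Multiset.mem_of_le h1S hy)) ((hmono _ (h1S.trans hSY)).trans hYt)
  · exact four_sums t ht _ _ h2X
      (fun y hy => hSm y (Multiset.mem_of_le h2S hy)) ((hmono _ (h2S.trans hSY)).trans hYt)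
end

section
/- There exist universal constants K_1, K_2 > 0 with the following property. For every additive abelian group G, every natural number n, all finite subsets A, B, C ⊆ G of size at most n, and every real number α with 0 < α < 1, there exist an integer k with 1 ≤ k ≤ K_1/α and subsets A_1, …, A_k ⊆ A and B_1, …, B_k ⊆ B such that: (1) the remainder set R = {(a, b) ∈ A × B : a + b ∈ C} \ ⋃_{i=1}^{k} (A_i × B_i) has size at most α·n²; and (2) |A_i + B_i| ≤ K_2 · n/α⁵ for every 1 ≤ i ≤ k. -/
theorem bsg_graph {X Y : Type*} (A : Finset X) (B : Finset Y) (e : X → Y → ℝ)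
    (he : ∀ a b, e a b = 0 ∨ e a b = 1) (n : ℕ) (hn : 0 < n)
    (hA : A.card ≤ n) (hB : B.card ≤ n) (x : ℝ) (hx : 0 < x)
    (hE : ∑ a ∈ A, ∑ b ∈ B, e a b = x * (n : ℝ) ^ 2) :
    ∃ A' ⊆ A, ∃ B' ⊆ B, x ^ 2 * (n : ℝ) ^ 2 / 24 ≤ ∑ a ∈ A', ∑ b ∈ B', e a b ∧
      ∀ a ∈ A', ∀ b ∈ B', x ^ 5 * (n : ℝ) ^ 2 / 12288 ≤
        ∑ a' ∈ A, ∑ b' ∈ B, e a b' * e a' b' * e a' b := by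
  classical
  have e0 : ∀ a b, 0 ≤ e a b := fun a b => by rcases he a b with h | h <;> rw [h] <;> norm_num
  have e1 : ∀ a b, e a b ≤ 1 := fun a b => by rcases he a b with h | h <;> rw [h] <;> norm_num
  have hN : (0 : ℝ) < n := by exact_mod_cast hn
  have hAr : (A.card : ℝ) ≤ n := by exact_mod_cast hA
  have hBr : (B.card : ℝ) ≤ n := by exact_mod_cast hB
  set N : ℝ := (n : ℝ) with hNdef
  set A0 := A.filter (fun a => x * N / 2 ≤ ∑ b ∈ B, e a b) with hA0
  have hA0A : A0 ⊆ A := Finset.filter_subset _ _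
  have hA0r : (A0.card : ℝ) ≤ N :=
    le_trans (by exact_mod_cast Finset.card_le_card hA0A) hAr
  have h1 : x * N ^ 2 / 2 ≤ ∑ a ∈ A0, ∑ b ∈ B, e a b := by
    have hs := Finset.sum_filter_add_sum_filter_not A
      (fun a => x * N / 2 ≤ ∑ b ∈ B, e a b) (fun a => ∑ b ∈ B, e a b)
    have hnot : ∑ a ∈ A.filter (fun a => ¬ x * N / 2 ≤ ∑ b ∈ B, e a b), ∑ b ∈ B, e a b
        ≤ N * (x * N / 2) := by
      calc _ ≤ ((A.filter (fun a => ¬ x * N / 2 ≤ ∑ b ∈ B, e a b)).card : ℝ) * (x * N / 2) := by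
            rw [← nsmul_eq_mul]
            apply Finset.sum_le_card_nsmul
            intro a ha
            exact (not_le.mp (Finset.mem_filter.mp ha).2).le
        _ ≤ _ := by
            apply mul_le_mul_of_nonneg_right _ (by positivity)
            exact le_trans (by exact_mod_cast Finset.card_le_card (Finset.filter_subset _ _)) hAr
    rw [hE] at hs
    nlinarith
  set δ : ℝ := x ^ 3 / 256 with hδ
  have hδ0 : 0 < δ := by positivity
  set cod : X → X → ℝ := fun a a' => ∑ b ∈ B, e a b * e a' b with hcod
  have cod0 : ∀ a a', 0 ≤ cod a a' := fun a a' =>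
    Finset.sum_nonneg fun b _ => mul_nonneg (e0 _ _) (e0 _ _)
  set bad : X → X → ℝ := fun a a' => if cod a a' < δ * N then 1 else 0 with hbad
  have bad0 : ∀ a a', 0 ≤ bad a a' := fun a a' => by
    simp only [hbad]; split_ifs <;> norm_num
  have badcod : ∀ a a', bad a a' * cod a a' ≤ δ * N := fun a a' => by
    simp only [hbad]; split_ifs with h
    · linarith
    · rw [zero_mul]; positivity
  have codbad : ∀ a a', δ * N * (1 - bad a a') ≤ cod a a' := fun a a' => by
    simp only [hbad]; split_ifs with h
    · have := cod0 a a'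
      linarith
    · linarith
  set d : Y → ℝ := fun b => ∑ a ∈ A0, e a b with hd
  set Bd : Y → ℝ := fun b => ∑ a ∈ A0, ∑ a' ∈ A0, bad a a' * (e a b * e a' b) with hBd
  have h2 : x * N ^ 2 / 2 ≤ ∑ b ∈ B, d b := by
    rw [Finset.sum_comm]; exact h1
  have hCS : x ^ 2 * N ^ 3 / 4 ≤ ∑ b ∈ B, d b ^ 2 := by
    have h := sq_sum_le_card_mul_sum_sq (s := B) (f := d)
    have hsq : (x * N ^ 2 / 2) ^ 2 ≤ (∑ b ∈ B, d b) ^ 2 := by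
      apply pow_le_pow_left₀ (by positivity) h2
    have h0 : 0 ≤ ∑ b ∈ B, d b ^ 2 := Finset.sum_nonneg fun b _ => sq_nonneg _
    have h4 : (B.card : ℝ) * ∑ b ∈ B, d b ^ 2 ≤ N * ∑ b ∈ B, d b ^ 2 :=
      mul_le_mul_of_nonneg_right hBr h0
    have h5 : N * (x ^ 2 * N ^ 3 / 4) ≤ N * ∑ b ∈ B, d b ^ 2 := by
      calc _ = (x * N ^ 2 / 2) ^ 2 := by ring
        _ ≤ _ := by linarith
    exact le_of_mul_le_mul_left h5 hN
  have h3 : ∑ b ∈ B, Bd b ≤ δ * N ^ 3 := by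
    have : ∑ b ∈ B, Bd b = ∑ a ∈ A0, ∑ a' ∈ A0, bad a a' * cod a a' := by
      simp only [hBd, hcod]
      rw [Finset.sum_comm]
      refine Finset.sum_congr rfl fun a _ => ?_
      rw [Finset.sum_comm]
      refine Finset.sum_congr rfl fun a' _ => ?_
      rw [Finset.mul_sum]
    rw [this]
    calc _ ≤ ∑ a ∈ A0, ∑ a' ∈ A0, δ * N :=
          Finset.sum_le_sum fun a _ => Finset.sum_le_sum fun a' _ => badcod a a'
      _ = (A0.card : ℝ) * ((A0.card : ℝ) * (δ * N)) := by simp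
      _ ≤ N * (N * (δ * N)) := by gcongr
      _ = _ := by ring
  obtain ⟨b, hbB, hb⟩ : ∃ b ∈ B, x ^ 2 * N ^ 2 / 9 < d b ^ 2 - Bd b * (32 / x) := by
    by_contra! hcon
    have hs : ∑ b ∈ B, (d b ^ 2 - Bd b * (32 / x)) ≤ N * (x ^ 2 * N ^ 2 / 9) := by
      calc _ ≤ (B.card : ℝ) * (x ^ 2 * N ^ 2 / 9) := by
            rw [← nsmul_eq_mul]
            exact Finset.sum_le_card_nsmul _ _ _ hcon
        _ ≤ _ := by gcongr
    rw [Finset.sum_sub_distrib, ← Finset.sum_mul] at hs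
    have h6 : (∑ b ∈ B, Bd b) * (32 / x) ≤ δ * N ^ 3 * (32 / x) := by gcongr
    have h7 : δ * N ^ 3 * (32 / x) = x ^ 2 * N ^ 3 / 8 := by
      rw [hδ]; field_simp; norm_num
    have h8 : 0 < x ^ 2 * N ^ 3 := by positivity
    nlinarith
  set D := d b with hD
  have hD0 : 0 ≤ D := Finset.sum_nonneg fun a _ => e0 _ _
  have hBd0 : 0 ≤ Bd b := Finset.sum_nonneg fun a _ => Finset.sum_nonneg fun a' _ =>
    mul_nonneg (bad0 _ _) (mul_nonneg (e0 _ _) (e0 _ _))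
  have hDlow : x * N / 3 ≤ D := by
    refine (sq_le_sq₀ (by positivity) hD0).mp ?_
    have : 0 ≤ Bd b * (32 / x) := by positivity
    nlinarith
  have hDpos : 0 < D := lt_of_lt_of_le (by positivity) hDlow
  have hBdD : Bd b ≤ x / 32 * D ^ 2 := by
    have h9 : Bd b * (32 / x) ≤ D ^ 2 := by
      have : 0 ≤ x ^ 2 * N ^ 2 / 9 := by positivity
      linarith
    calc Bd b = x / 32 * (Bd b * (32 / x)) := by field_simp
      _ ≤ _ := by gcongr
  set β : X → ℝ := fun a => ∑ a' ∈ A0, bad a a' * e a' b with hβ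
  have β0 : ∀ a, 0 ≤ β a := fun a => Finset.sum_nonneg fun a' _ => mul_nonneg (bad0 _ _) (e0 _ _)
  set A2 := A0.filter (fun a => e a b = 1 ∧ β a ≤ x / 16 * D) with hA2
  have hA2A0 : A2 ⊆ A0 := Finset.filter_subset _ _
  have hA2card : D / 2 ≤ (A2.card : ℝ) := by
    have hpt : ∀ a ∈ A0, e a b ≤ (if e a b = 1 ∧ β a ≤ x / 16 * D then (1 : ℝ) else 0)
        + e a b * β a / (x / 16 * D) := by
      intro a _
      have hnn : 0 ≤ e a b * β a / (x / 16 * D) :=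
        div_nonneg (mul_nonneg (e0 _ _) (β0 _)) (by positivity)
      split_ifs with h
      · have := e1 a b
        linarith
      · rcases he a b with h' | h'
        · rw [h']; simp
        · have h'' : x / 16 * D < β a := by
            by_contra hc
            exact h ⟨h', not_lt.mp hc⟩
          rw [h', zero_add, one_mul, le_div_iff₀ (by positivity)]
          linarith
    have hs := Finset.sum_le_sum hpt
    rw [Finset.sum_add_distrib, ← Finset.sum_div, Finset.sum_boole] at hs
    have hBdeq : ∑ a ∈ A0, e a b * β a = Bd b := by
      simp only [hBd, hβ]
      refine Finset.sum_congr rfl fun a _ => ?_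
      rw [Finset.mul_sum]
      refine Finset.sum_congr rfl fun a' _ => ?_
      ring
    rw [hBdeq] at hs
    have h10 : Bd b / (x / 16 * D) ≤ D / 2 := by
      rw [div_le_iff₀ (by positivity)]
      nlinarith
    have h11 : D ≤ (A2.card : ℝ) + Bd b / (x / 16 * D) := hs
    linarith
  have hedge : D * x * N / 4 ≤ ∑ a ∈ A2, ∑ b' ∈ B, e a b' := by
    calc D * x * N / 4 = D / 2 * (x * N / 2) := by ring
      _ ≤ (A2.card : ℝ) * (x * N / 2) := by gcongr
      _ ≤ _ := by
        rw [← nsmul_eq_mul]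
        apply Finset.card_nsmul_le_sum
        intro a ha
        exact (Finset.mem_filter.mp (hA2A0 ha)).2
  refine ⟨A2, hA2A0.trans hA0A, B.filter (fun b' => x * D / 8 ≤ ∑ a ∈ A2, e a b'),
    Finset.filter_subset _ _, ?_, ?_⟩
  · rw [Finset.sum_comm]
    rw [Finset.sum_comm] at hedge
    have hs := Finset.sum_filter_add_sum_filter_not B
      (fun b' => x * D / 8 ≤ ∑ a ∈ A2, e a b') (fun b' => ∑ a ∈ A2, e a b')
    have hnot : ∑ b' ∈ B.filter (fun b' => ¬ x * D / 8 ≤ ∑ a ∈ A2, e a b'), ∑ a ∈ A2, e a b'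
        ≤ N * (x * D / 8) := by
      calc _ ≤ ((B.filter (fun b' => ¬ x * D / 8 ≤ ∑ a ∈ A2, e a b')).card : ℝ) * (x * D / 8) := by
            rw [← nsmul_eq_mul]
            apply Finset.sum_le_card_nsmul
            intro a ha
            exact (not_le.mp (Finset.mem_filter.mp ha).2).le
        _ ≤ _ := by
            apply mul_le_mul_of_nonneg_right _ (by positivity)
            exact le_trans (by exact_mod_cast Finset.card_le_card (Finset.filter_subset _ _)) hBr
    have h12 : x ^ 2 * N ^ 2 / 24 ≤ x * N * D / 8 := by
      calc x ^ 2 * N ^ 2 / 24 = x * N * (x * N / 3) / 8 := by ring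
        _ ≤ _ := by gcongr
    linarith
  · intro a ha b' hb'
    have hb2 := (Finset.mem_filter.mp hb').2
    have ha2 := (Finset.mem_filter.mp ha).2.2
    have hcodsum : ∑ a' ∈ A, ∑ b'' ∈ B, e a b'' * e a' b'' * e a' b'
        = ∑ a' ∈ A, cod a a' * e a' b' := by
      refine Finset.sum_congr rfl fun a' _ => ?_
      rw [Finset.sum_mul]
    rw [hcodsum]
    have hbadsum : ∑ a' ∈ A2, bad a a' ≤ x / 16 * D := by
      calc _ = ∑ a' ∈ A2, bad a a' * e a' b := by
            refine Finset.sum_congr rfl fun a' ha' => ?_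
            rw [(Finset.mem_filter.mp ha').2.1, mul_one]
        _ ≤ β a := Finset.sum_le_sum_of_subset_of_nonneg hA2A0
            fun i _ _ => mul_nonneg (bad0 _ _) (e0 _ _)
        _ ≤ _ := ha2
    calc x ^ 5 * N ^ 2 / 12288 = δ * N * (x * (x * N / 3) / 16) := by rw [hδ]; ring
      _ ≤ δ * N * (x * D / 16) := by gcongr
      _ ≤ δ * N * (∑ a' ∈ A2, e a' b' - ∑ a' ∈ A2, bad a a') := by
          apply mul_le_mul_of_nonneg_left _ (by positivity)
          linarith
      _ = ∑ a' ∈ A2, δ * N * (e a' b' - bad a a') := by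
          rw [← Finset.sum_sub_distrib, Finset.mul_sum]
      _ ≤ ∑ a' ∈ A2, cod a a' * e a' b' := by
          refine Finset.sum_le_sum fun a' _ => ?_
          rcases he a' b' with h | h
          · rw [h, mul_zero]
            have := mul_nonneg (mul_nonneg hδ0.le hN.le) (bad0 a a')
            linarith
          · rw [h, mul_one]
            exact codbad a a'
      _ ≤ _ := Finset.sum_le_sum_of_subset_of_nonneg (hA2A0.trans hA0A)
            fun i _ _ => mul_nonneg (cod0 _ _) (e0 _ _)

open Pointwise in
theorem bsg_sumset {G : Type*} [AddCommGroup G] [DecidableEq G] (A B C A' B' : Finset G)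
    (E : Finset (G × G)) (hEC : ∀ p ∈ E, p.1 + p.2 ∈ C) (P : ℝ)
    (hP : ∀ a ∈ A', ∀ b ∈ B', P ≤ (((A ×ˢ B).filter
      (fun p => (a, p.2) ∈ E ∧ (p.1, p.2) ∈ E ∧ (p.1, b) ∈ E)).card : ℝ)) :
    ((A' + B').card : ℝ) * P ≤ (C.card : ℝ) ^ 3 := by
  set T : G → Finset (G × G × G) := fun s =>
    (C ×ˢ C ×ˢ C).filter (fun t => t.1 - t.2.1 + t.2.2 = s) with hT
  have hTcard : ∀ s ∈ A' + B', P ≤ ((T s).card : ℝ) := by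
    intro s hs
    obtain ⟨a, ha, b, hb, rfl⟩ := Finset.mem_add.mp hs
    refine (hP a ha b hb).trans ?_
    norm_cast
    apply Finset.card_le_card_of_injOn (fun p => (a + p.2, p.1 + p.2, p.1 + b))
    · intro p hp
      have hp' := (Finset.mem_filter.mp hp).2
      simp only [hT, Finset.coe_filter, Finset.mem_product, Set.mem_ofPred_eq]
      exact ⟨⟨hEC _ hp'.1, hEC _ hp'.2.1, hEC _ hp'.2.2⟩, by abel⟩
    · intro p _ q _ hpq
      simp only [Prod.mk.injEq, add_right_inj, add_left_inj] at hpq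
      exact Prod.ext hpq.2.2 hpq.1
  have hdis : ((A' + B').biUnion T).card = ∑ s ∈ A' + B', (T s).card := by
    apply Finset.card_biUnion
    intro s _ s' _ hne
    refine Finset.disjoint_left.mpr ?_
    intro t ht ht'
    exact hne ((Finset.mem_filter.mp ht).2.symm.trans (Finset.mem_filter.mp ht').2)
  have hle : ((A' + B').biUnion T).card ≤ C.card ^ 3 := by
    calc _ ≤ (C ×ˢ C ×ˢ C).card := Finset.card_le_card
          (Finset.biUnion_subset.mpr fun s _ => Finset.filter_subset _ _)
      _ = _ := by simp only [Finset.card_product]; ring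
  calc ((A' + B').card : ℝ) * P ≤ ∑ s ∈ A' + B', ((T s).card : ℝ) := by
        rw [← nsmul_eq_mul]
        exact Finset.card_nsmul_le_sum _ _ _ hTcard
    _ = (((A' + B').biUnion T).card : ℝ) := by rw [hdis]; push_cast; rfl
    _ ≤ _ := by exact_mod_cast hle

open Pointwise in
theorem bsg_step {G : Type*} [AddCommGroup G] [DecidableEq G] (n : ℕ) (hn : 0 < n)
    (A B C : Finset G) (hA : A.card ≤ n) (hB : B.card ≤ n) (hC : C.card ≤ n)
    (E : Finset (G × G)) (hE : E ⊆ A ×ˢ B) (hEC : ∀ p ∈ E, p.1 + p.2 ∈ C)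
    (x : ℝ) (hx : 0 < x) (hEx : (E.card : ℝ) = x * (n : ℝ) ^ 2) :
    ∃ A' ⊆ A, ∃ B' ⊆ B,
      x ^ 2 * (n : ℝ) ^ 2 / 24 ≤ ((E.filter (fun p => p.1 ∈ A' ∧ p.2 ∈ B')).card : ℝ) ∧
      ((A' + B').card : ℝ) ≤ 12288 * n / x ^ 5 := by
  have hN : (0 : ℝ) < n := by exact_mod_cast hn
  have hsum : ∀ A' ⊆ A, ∀ B' ⊆ B,
      ∑ a ∈ A', ∑ b ∈ B', (if (a, b) ∈ E then (1 : ℝ) else 0)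
        = ((E.filter (fun p => p.1 ∈ A' ∧ p.2 ∈ B')).card : ℝ) := by
    intro A' _ B' _
    rw [← Finset.sum_product' A' B' (fun a b => if (a, b) ∈ E then (1 : ℝ) else 0),
      Finset.sum_boole]
    congr 2
    ext p
    simp only [Finset.mem_filter, Finset.mem_product]
    tauto
  obtain ⟨A', hA', B', hB', h1, h2⟩ := bsg_graph A B
    (fun a b => if (a, b) ∈ E then (1 : ℝ) else 0)
    (fun a b => by by_cases h : (a, b) ∈ E <;> simp [h]) n hn hA hB x hx (by
      rw [hsum A subset_rfl B subset_rfl, ← hEx]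
      congr 2
      apply Finset.filter_true_of_mem
      intro p hp
      exact Finset.mem_product.mp (hE hp))
  refine ⟨A', hA', B', hB', ?_, ?_⟩
  · rw [← hsum A' hA' B' hB']; exact h1
  · have h3 := bsg_sumset A B C A' B' E hEC (x ^ 5 * (n : ℝ) ^ 2 / 12288) (by
      intro a ha b hb
      refine (h2 a ha b hb).trans (le_of_eq ?_)
      rw [← Finset.sum_product' A B (fun a' b' => (if (a, b') ∈ E then (1 : ℝ) else 0) *
        (if (a', b') ∈ E then (1 : ℝ) else 0) * (if (a', b) ∈ E then (1 : ℝ) else 0)),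
        ← Finset.sum_boole]
      refine Finset.sum_congr rfl fun p _ => ?_
      by_cases h : (a, p.2) ∈ E <;> by_cases h' : (p.1, p.2) ∈ E <;>
        by_cases h'' : (p.1, b) ∈ E <;> simp [h, h', h''])
    have h4 : (C.card : ℝ) ^ 3 ≤ (n : ℝ) ^ 3 := by
      have : (C.card : ℝ) ≤ n := by exact_mod_cast hC
      gcongr
    rw [le_div_iff₀ (by positivity)]
    have h5 : ((A' + B').card : ℝ) * x ^ 5 * (n : ℝ) ^ 2 ≤ 12288 * n * (n : ℝ) ^ 2 := by
      nlinarith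
    exact le_of_mul_le_mul_right h5 (by positivity)

open Pointwise in
theorem bsg_iter {G : Type*} [AddCommGroup G] [DecidableEq G] (n : ℕ) (hn : 0 < n)
    (A B C : Finset G) (hA : A.card ≤ n) (hB : B.card ≤ n) (hC : C.card ≤ n)
    (α : ℝ) (hα : 0 < α) (m : ℕ) :
    ∀ (E : Finset (G × G)), E.card = m → E ⊆ A ×ˢ B → (∀ p ∈ E, p.1 + p.2 ∈ C) →
    ∃ (k : ℕ) (𝒜 ℬ : Fin k → Finset G),
      1 ≤ k ∧ (k = 1 ∨ (α * (n : ℝ) ^ 2 < E.card ∧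
        (k : ℝ) ≤ 2 + 24 / α - 24 / ((E.card : ℝ) / (n : ℝ) ^ 2))) ∧
      (∀ i, 𝒜 i ⊆ A) ∧ (∀ i, ℬ i ⊆ B) ∧
      (((E.filter (fun p => ∀ i, ¬(p.1 ∈ 𝒜 i ∧ p.2 ∈ ℬ i))).card : ℝ) ≤ α * (n : ℝ) ^ 2) ∧
      (∀ i, ((𝒜 i + ℬ i).card : ℝ) ≤ 12288 * n / α ^ 5) := by
  have hN : (0 : ℝ) < n := by exact_mod_cast hn
  induction m using Nat.strong_induction_on with
  | _ m ih =>
  intro E hm hE hEC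
  by_cases hsmall : (E.card : ℝ) ≤ α * (n : ℝ) ^ 2
  · refine ⟨1, fun _ => ∅, fun _ => ∅, le_rfl, Or.inl rfl, by simp, by simp, ?_, ?_⟩
    · refine le_trans ?_ hsmall
      exact_mod_cast Finset.card_le_card (Finset.filter_subset _ _)
    · intro i
      simp only [Finset.add_empty, Finset.card_empty, Nat.cast_zero]
      positivity
  push Not at hsmall
  set x : ℝ := (E.card : ℝ) / (n : ℝ) ^ 2 with hxdef
  have hEx : (E.card : ℝ) = x * (n : ℝ) ^ 2 := (div_mul_cancel₀ _ (by positivity)).symm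
  have hαx : α < x := by rw [hxdef, lt_div_iff₀ (by positivity)]; exact hsmall
  have hx : 0 < x := hα.trans hαx
  obtain ⟨A', hA', B', hB', h1, h2⟩ := bsg_step n hn A B C hA hB hC E hE hEC x hx hEx
  set E' := E.filter (fun p => ¬ (p.1 ∈ A' ∧ p.2 ∈ B')) with hE'
  have hcard : ((E.filter (fun p => p.1 ∈ A' ∧ p.2 ∈ B')).card : ℝ) + E'.card = E.card := by
    exact_mod_cast Finset.card_filter_add_card_filter_not (s := E) (fun p => p.1 ∈ A' ∧ p.2 ∈ B')
  have hlt : E'.card < m := by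
    have h3 : (0 : ℝ) < x ^ 2 * (n : ℝ) ^ 2 / 24 :=
      div_pos (mul_pos (pow_pos hx 2) (pow_pos hN 2)) (by norm_num)
    have : (E'.card : ℝ) < E.card := by linarith
    rw [← hm]
    exact_mod_cast this
  obtain ⟨k, 𝒜, ℬ, hk1, hk2, hkA, hkB, hkR, hkS⟩ := ih _ hlt E' rfl
    ((Finset.filter_subset _ _).trans hE) (fun p hp => hEC p (Finset.mem_filter.mp hp).1)
  refine ⟨k + 1, Fin.cons A' 𝒜, Fin.cons B' ℬ, by omega, Or.inr ⟨hsmall, ?_⟩, ?_, ?_, ?_, ?_⟩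
  · push_cast
    rcases hk2 with hk | ⟨hk, hk'⟩
    · subst hk
      have : 24 / x ≤ 24 / α := div_le_div_of_nonneg_left (by norm_num) hα hαx.le
      push_cast
      linarith
    · set y : ℝ := (E'.card : ℝ) / (n : ℝ) ^ 2 with hydef
      have hEy : (E'.card : ℝ) = y * (n : ℝ) ^ 2 := (div_mul_cancel₀ _ (by positivity)).symm
      have hαy : α < y := by rw [hydef, lt_div_iff₀ (by positivity)]; exact hk
      have hy : 0 < y := hα.trans hαy
      have hxy : y ≤ x - x ^ 2 / 24 := by
        have : y * (n : ℝ) ^ 2 ≤ (x - x ^ 2 / 24) * (n : ℝ) ^ 2 := by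
          rw [← hEy, sub_mul, ← hEx]
          linarith
        exact le_of_mul_le_mul_right this (by positivity)
      have hkey : 1 + 24 / x ≤ 24 / y := by
        rw [le_div_iff₀ hy]
        have h6 : (1 + 24 / x) * y = (x + 24) * y / x := by field_simp
        rw [h6, div_le_iff₀ hx]
        have hyx : y ≤ x := by nlinarith [sq_nonneg x]
        nlinarith
      linarith
  · intro i
    refine Fin.cases ?_ ?_ i
    · simpa using hA'
    · intro j; simpa using hkA j
  · intro i
    refine Fin.cases ?_ ?_ i
    · simpa using hB'
    · intro j; simpa using hkB j
  · refine le_trans (le_of_eq ?_) hkR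
    congr 2
    ext p
    simp only [hE', Finset.mem_filter, Fin.forall_fin_succ, Fin.cons_zero, Fin.cons_succ]
    tauto
  · intro i
    refine Fin.cases ?_ ?_ i
    · simp only [Fin.cons_zero]
      refine h2.trans ?_
      gcongr
    · intro j; simpa using hkS j

open Pointwise in
/-- **BSG corollary (existence form).**
There are universal constants `K₁, K₂ > 0` such that for every additive abelian group `G`,
every `n`, all finite `A, B, C ⊆ G` of size at most `n`, and every `0 < α < 1`, there are
`1 ≤ k ≤ K₁/α` and subsets `Aᵢ ⊆ A`, `Bᵢ ⊆ B` such that the remainder set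
`R = {(a,b) ∈ A × B : a + b ∈ C} \ ⋃ᵢ (Aᵢ × Bᵢ)` has size at most `α·n²` and
`|Aᵢ + Bᵢ| ≤ K₂·n/α⁵` for all `i`. -/
theorem bsg_corollary :
    ∃ K₁ K₂ : ℝ, 0 < K₁ ∧ 0 < K₂ ∧
      ∀ (G : Type*) [AddCommGroup G] [DecidableEq G] (n : ℕ) (A B C : Finset G),
        A.card ≤ n → B.card ≤ n → C.card ≤ n →
        ∀ α : ℝ, 0 < α → α < 1 →
        ∃ (k : ℕ) (𝒜 ℬ : Fin k → Finset G),
          1 ≤ k ∧ (k : ℝ) ≤ K₁ / α ∧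
          (∀ i, 𝒜 i ⊆ A) ∧ (∀ i, ℬ i ⊆ B) ∧
          ((((A ×ˢ B).filter
            (fun p => p.1 + p.2 ∈ C ∧ ∀ i, ¬(p.1 ∈ 𝒜 i ∧ p.2 ∈ ℬ i))).card : ℝ)
              ≤ α * (n : ℝ) ^ 2) ∧
          (∀ i, ((𝒜 i + ℬ i).card : ℝ) ≤ K₂ * n / α ^ 5) := by
  refine ⟨26, 12288, by norm_num, by norm_num, ?_⟩
  intro G _ _ n A B C hA hB hC α hα hα1
  have hone : 1 < 1 / α := by rw [lt_div_iff₀ hα]; linarith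
  have h26 : 26 / α = 26 * (1 / α) := by ring
  have h24 : 24 / α = 24 * (1 / α) := by ring
  rcases Nat.eq_zero_or_pos n with hn | hn
  · subst hn
    have hA0 : A = ∅ := Finset.card_eq_zero.mp (Nat.le_zero.mp hA)
    subst hA0
    refine ⟨1, fun _ => ∅, fun _ => ∅, le_rfl, ?_, by simp, by simp, by simp, by simp⟩
    push_cast
    linarith
  · obtain ⟨k, 𝒜, ℬ, hk1, hk2, hkA, hkB, hkR, hkS⟩ := bsg_iter n hn A B C hA hB hC α hα _
      ((A ×ˢ B).filter (fun p => p.1 + p.2 ∈ C)) rfl (Finset.filter_subset _ _)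
      (fun p hp => (Finset.mem_filter.mp hp).2)
    refine ⟨k, 𝒜, ℬ, hk1, ?_, hkA, hkB, ?_, hkS⟩
    · rcases hk2 with hk | ⟨_, hk⟩
      · subst hk
        push_cast
        linarith
      · have : (0 : ℝ) ≤ 24 / ((((A ×ˢ B).filter (fun p => p.1 + p.2 ∈ C)).card : ℝ)
          / (n : ℝ) ^ 2) := by positivity
        linarith
    · rw [Finset.filter_filter] at hkR
      exact hkR
end
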